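/- Let I be a compact Hausdorff space and let f_i : ℝ^m → ℝ, i ∈ I, be convex functions such that (i,x) ↦ f_i(x) is continuous on I × ℝ^m; set f(x) := max_{i∈I} f_i(x) and I_f(x) := {i ∈ I : f_i(x) = f(x)}. Let x̄ ∈ ℝ^m with f(x̄) = 0 and suppose min_{‖h‖=1} f'(x̄,h) ≠ 0. Then there exist constants c, ε > 0 such that whenever G ∈ C(I × ℝ^m, ℝ), with g_i(x) := G(i,x), each g_i is convex, g(x) := max_{i∈I} g_i(x), I_g(x) := {i ∈ I : g_i(x) = g(x)}, and: g(x̄) = 0; I_g(x̄) ⊆ I_f(x̄) whenever min_{‖h‖=1} f'(x̄,h) < 0; I_f(x̄) ⊆ I_g(x̄) whenever min_{‖h‖=1} f'(x̄,h) > 0; and limsup_{x→x̄} |f_i(x) − g_i(x) − (f_i(x̄) − g_i(x̄))| / ‖x−x̄‖ ≤ ε for all i ∈ I_f(x̄) ∩ I_g(x̄), one has τ_min(G, x̄) ≤ c. -/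

import Mathlib

open Filter Metric Set Topology
open scoped ENNReal

noncomputable section

/-- The Euclidean space `ℝ^m`. -/
abbrev Euc (m : ℕ) := EuclideanSpace ℝ (Fin m)

/-- Directional derivative `g'(x,h) = inf_{t>0} (g(x+th) - g(x))/t` of a real-valued
convex function. -/
def rDirDeriv {m : ℕ} (g : Euc m → ℝ) (x h : Euc m) : ℝ :=
  ⨅ t : {t : ℝ // 0 < t}, (g (x + (t : ℝ) • h) - g x) / (t : ℝ)

/-- `min_{‖h‖=1} g'(x,h)`. -/
def rMinDirDeriv {m : ℕ} (g : Euc m → ℝ) (x : Euc m) : ℝ :=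
  ⨅ h : sphere (0 : Euc m) 1, rDirDeriv g x (h : Euc m)

/-- `f(x) = max_{i ∈ I} f_i(x)`. -/
def fmax {m : ℕ} {I : Type*} [Nonempty I] (F : I → Euc m → ℝ) (x : Euc m) : ℝ := ⨆ i, F i x

/-- The active index set `I_f(x) = {i ∈ I : f_i(x) = f(x)}`. -/
def activeSet {m : ℕ} {I : Type*} [Nonempty I] (F : I → Euc m → ℝ) (x : Euc m) : Set I :=
  {i | F i x = fmax F x}

/-- The solution set `S_G = {x : g_i(x) ≤ 0 for all i ∈ I}` of the system. -/
def SG {m : ℕ} {I : Type*} (G : I → Euc m → ℝ) : Set (Euc m) := {x | ∀ i, G i x ≤ 0}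

/-- The local error bound modulus `τ_min(G, x₀)` of the system (in `ℝ≥0∞`). -/
def tauMinLocSys {m : ℕ} {I : Type*} [Nonempty I] (G : I → Euc m → ℝ) (x₀ : Euc m) : ℝ≥0∞ :=
  ⨅ τ ∈ {τ : ℝ | 0 < τ ∧ ∃ δ > (0:ℝ), ∀ x ∈ ball x₀ δ,
      EMetric.infEdist x (SG G) ≤ ENNReal.ofReal (τ * max (fmax G x) 0)},
    ENNReal.ofReal τ

/-- The global error bound modulus `τ_min(G)` of the system (in `ℝ≥0∞`). -/
def tauMinSys {m : ℕ} {I : Type*} [Nonempty I] (G : I → Euc m → ℝ) : ℝ≥0∞ :=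
  ⨅ τ ∈ {τ : ℝ | 0 < τ ∧ ∀ x,
      EMetric.infEdist x (SG G) ≤ ENNReal.ofReal (τ * max (fmax G x) 0)},
    ENNReal.ofReal τ

section SystemErrorBound

variable {m : ℕ} {I : Type*}

/-- Along a ray from a point where a convex function is nonpositive, `φ (x + s • h) / s` is
nondecreasing in `s`. -/
lemma ConvexOn.mul_ray_le {φ : Euc m → ℝ} (hφ : ConvexOn ℝ univ φ) {x h : Euc m} (h0 : φ x ≤ 0)
    {s t : ℝ} (hs : 0 < s) (hst : s ≤ t) : t * φ (x + s • h) ≤ s * φ (x + t • h) := by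
  have ht : 0 < t := hs.trans_le hst
  have hst1 : s / t ≤ 1 := (div_le_one ht).2 hst
  have key := hφ.2 (mem_univ x) (mem_univ (x + t • h)) (sub_nonneg.2 hst1)
    (div_pos hs ht).le (by ring)
  have hpt : (1 - s / t) • x + (s / t) • (x + t • h) = x + s • h := by
    have : s / t * t = s := div_mul_cancel₀ s ht.ne'
    rw [smul_add, smul_smul, this, ← add_assoc, ← add_smul]
    simp
  rw [hpt, smul_eq_mul, smul_eq_mul] at key
  calc t * φ (x + s • h) ≤ t * ((1 - s / t) * φ x + s / t * φ (x + t • h)) := by gcongr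
    _ = (t - s) * φ x + s * φ (x + t • h) := by field_simp
    _ ≤ s * φ (x + t • h) := by nlinarith

/-- A bound on the upper limit of difference quotients gives a linear bound along rays. -/
lemma eventually_abs_ray_le_of_limsup_le {d : Euc m → ℝ} {x h : Euc m} (hh : ‖h‖ = 1)
    {ε ε' : ℝ} (hε : 0 < ε') (hεε' : ε < ε')
    (hlim : limsup (fun y => ENNReal.ofReal |d y| / edist y x) (𝓝[≠] x) ≤ ENNReal.ofReal ε) :
    ∀ᶠ s : ℝ in 𝓝[>] 0, |d (x + s • h)| ≤ ε' * s := by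
  have hev := eventually_lt_of_limsup_lt
    (hlim.trans_lt ((ENNReal.ofReal_lt_ofReal_iff hε).2 hεε'))
  have hne : h ≠ 0 := by rintro rfl; simp at hh
  have htend : Tendsto (fun s : ℝ => x + s • h) (𝓝[>] 0) (𝓝[≠] x) := by
    refine tendsto_nhdsWithin_iff.2 ⟨?_, ?_⟩
    · have hc : Continuous fun s : ℝ => x + s • h := by fun_prop
      have := hc.tendsto 0
      simp only [zero_smul, add_zero] at this
      exact this.mono_left nhdsWithin_le_nhds
    · filter_upwards [self_mem_nhdsWithin] with s hs
      simpa [hne] using (mem_Ioi.1 hs).ne'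
  filter_upwards [htend.eventually hev, self_mem_nhdsWithin] with s hs hpos
  have hpos : 0 < s := hpos
  have hed : edist (x + s • h) x = ENNReal.ofReal s := by
    rw [edist_dist, dist_eq_norm]
    simp [norm_smul, hh, abs_of_pos hpos]
  rw [hed] at hs
  have hle := (ENNReal.div_le_iff (ENNReal.ofReal_pos.2 hpos).ne' ENNReal.ofReal_ne_top).1 hs.le
  rw [← ENNReal.ofReal_mul hε.le] at hle
  exact (ENNReal.ofReal_le_ofReal_iff (by positivity)).1 hle

lemma tauMinLocSys_le [Nonempty I] {G : I → Euc m → ℝ} {x₀ : Euc m} {τ δ : ℝ} (hτ : 0 < τ) (hδ : 0 < δ)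
    (h : ∀ x ∈ ball x₀ δ, ∃ w ∈ SG G, dist x w ≤ τ * max (fmax G x) 0) :
    tauMinLocSys G x₀ ≤ ENNReal.ofReal τ := by
  refine iInf₂_le τ ⟨hτ, δ, hδ, fun x hx => ?_⟩
  obtain ⟨w, hw, hd⟩ := h x hx
  refine (infEDist_le_edist_of_mem hw).trans ?_
  rw [edist_dist]
  exact ENNReal.ofReal_le_ofReal hd

variable [TopologicalSpace I] [CompactSpace I]

/-- If at every positive time some member of a compact convex family grows along a ray at least
at rate `a`, then a single member, active at the base point, does so at all positive times. -/
lemma exists_forall_mul_le_ray {H : I → Euc m → ℝ}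
    (hcont : Continuous fun p : I × Euc m => H p.1 p.2)
    (hconv : ∀ i, ConvexOn ℝ univ (H i)) {x h : Euc m} (h0 : ∀ i, H i x ≤ 0) {a : ℝ}
    (hex : ∀ s : ℝ, 0 < s → ∃ i, a * s ≤ H i (x + s • h)) :
    ∃ i, H i x = 0 ∧ ∀ s : ℝ, 0 < s → a * s ≤ H i (x + s • h) := by
  let A : {s : ℝ // 0 < s} → Set I := fun s => {i | a * s ≤ H i (x + (s : ℝ) • h)}
  have hclosed : ∀ s, IsClosed (A s) := fun s =>
    isClosed_le continuous_const
      (hcont.comp (by fun_prop : Continuous fun i : I => (i, x + (s : ℝ) • h)))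
  have hmono : ∀ s t : {s : ℝ // 0 < s}, s ≤ t → A s ⊆ A t := by
    rintro ⟨s, hs⟩ ⟨t, ht⟩ hst i hi
    have hi : a * s ≤ H i (x + s • h) := hi
    have h1 := (hconv i).mul_ray_le (h := h) (h0 i) hs hst
    have h2 : s * (a * t) ≤ s * H i (x + t • h) := by nlinarith
    exact le_of_mul_le_mul_left h2 hs
  have : Nonempty {s : ℝ // 0 < s} := ⟨⟨1, one_pos⟩⟩
  obtain ⟨i, hi⟩ := IsCompact.nonempty_iInter_of_directed_nonempty_isCompact_isClosed A
    (fun s t => ⟨min s t, hmono _ _ (min_le_left _ _), hmono _ _ (min_le_right _ _)⟩)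
    (fun s => hex s s.2) (fun s => (hclosed s).isCompact) hclosed
  have hall : ∀ s : ℝ, 0 < s → a * s ≤ H i (x + s • h) := fun s hs => mem_iInter.1 hi ⟨s, hs⟩
  refine ⟨i, (h0 i).antisymm ?_, hall⟩
  have hr : Continuous fun s : ℝ => H i (x + s • h) :=
    hcont.comp (by fun_prop : Continuous fun s : ℝ => (i, x + s • h))
  have hl : Continuous fun s : ℝ => a * s := by fun_prop
  have h1 := (hr.tendsto 0).mono_left (nhdsWithin_le_nhds (s := Ioi 0))
  have h2 := (hl.tendsto 0).mono_left (nhdsWithin_le_nhds (s := Ioi 0))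
  have := le_of_tendsto_of_tendsto h2 h1
    (by filter_upwards [self_mem_nhdsWithin] with s hs using hall s hs)
  simpa using this

variable [Nonempty I]

lemma le_fmax {H : I → Euc m → ℝ} (hcont : Continuous fun p : I × Euc m => H p.1 p.2)
    (i : I) (x : Euc m) : H i x ≤ fmax H x := by
  have hc : Continuous fun i => H i x := hcont.comp (Continuous.prodMk_left x)
  exact le_ciSup (isCompact_range hc).bddAbove i

lemma exists_eq_fmax {H : I → Euc m → ℝ} (hcont : Continuous fun p : I × Euc m => H p.1 p.2)
    (x : Euc m) : ∃ i, H i x = fmax H x := by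
  have hc : Continuous fun i => H i x := hcont.comp (Continuous.prodMk_left x)
  exact (isCompact_range hc).sSup_mem (range_nonempty _)

/-- A Slater point at distance `s` from `x₀` with value at most `-η * s` gives a local error
bound with modulus `2 / η`. -/
lemma tauMinLocSys_le_of_slater {G : I → Euc m → ℝ}
    (hcont : Continuous fun p : I × Euc m => G p.1 p.2) (hconv : ∀ i, ConvexOn ℝ univ (G i))
    {x₀ z : Euc m} {η s : ℝ} (hη : 0 < η) (hs : 0 < s) (hz : dist x₀ z ≤ s)
    (hGz : ∀ i, G i z ≤ -η * s) : tauMinLocSys G x₀ ≤ ENNReal.ofReal (2 / η) := by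
  refine tauMinLocSys_le (by positivity) hs fun x hx => ?_
  rcases le_or_gt (fmax G x) 0 with hg | hg
  · refine ⟨x, fun i => (le_fmax hcont i x).trans hg, ?_⟩
    rw [dist_self]
    positivity
  have hηs : 0 < η * s := mul_pos hη hs
  have hden : 0 < fmax G x + η * s := by positivity
  set l := fmax G x / (fmax G x + η * s) with hl
  have hl0 : 0 ≤ l := by positivity
  have hl1 : 1 - l = η * s / (fmax G x + η * s) := by rw [hl]; field_simp; ring
  have hl1' : 0 ≤ 1 - l := by rw [hl1]; positivity
  refine ⟨(1 - l) • x + l • z, fun i => ?_, ?_⟩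
  · have h1 := (hconv i).2 (mem_univ x) (mem_univ z) hl1' hl0 (by ring)
    simp only [smul_eq_mul] at h1
    calc _ ≤ (1 - l) * G i x + l * G i z := h1
      _ ≤ (1 - l) * fmax G x + l * (-η * s) := by
        gcongr
        · exact le_fmax hcont i x
        · exact hGz i
      _ = 0 := by rw [hl1, hl]; field_simp; ring
  · have hd : dist x ((1 - l) • x + l • z) = l * dist x z := by
      have : x - ((1 - l) • x + l • z) = l • (x - z) := by module
      rw [dist_eq_norm, this, norm_smul, Real.norm_of_nonneg hl0, dist_eq_norm]
    have hxz : dist x z ≤ 2 * s := by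
      linarith [dist_triangle x x₀ z, mem_ball.1 hx]
    have hl2 : l ≤ fmax G x / (η * s) := by
      rw [hl]
      gcongr
      linarith
    rw [hd, max_eq_left hg.le]
    calc l * dist x z ≤ fmax G x / (η * s) * (2 * s) := by gcongr
      _ = 2 / η * fmax G x := by field_simp

lemma exists_slope_neg_of_rMinDirDeriv_neg {f : Euc m → ℝ} {x : Euc m}
    (hneg : rMinDirDeriv f x < 0) :
    ∃ h : Euc m, ‖h‖ = 1 ∧ ∃ t : ℝ, 0 < t ∧ (f (x + t • h) - f x) / t < 0 := by
  rcases isEmpty_or_nonempty (sphere (0 : Euc m) 1) with he | hne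
  · rw [rMinDirDeriv, Real.iInf_of_isEmpty] at hneg
    exact absurd hneg (lt_irrefl _)
  obtain ⟨⟨h, hh⟩, hlt⟩ := exists_lt_of_ciInf_lt hneg
  have : Nonempty {s : ℝ // 0 < s} := ⟨⟨1, one_pos⟩⟩
  obtain ⟨⟨t, ht⟩, hlt⟩ := exists_lt_of_ciInf_lt hlt
  exact ⟨h, by simpa using hh, t, ht, hlt⟩

lemma Real.iInf_le_of_iInf_pos {ι : Sort*} {u : ι → ℝ} (hu : 0 < ⨅ i, u i) (i : ι) :
    ⨅ i, u i ≤ u i := by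
  refine ciInf_le ?_ i
  by_contra hb
  rw [Real.iInf_of_not_bddBelow hb] at hu
  exact lt_irrefl _ hu

lemma rMinDirDeriv_le_slope {f : Euc m → ℝ} {x : Euc m} (hpos : 0 < rMinDirDeriv f x)
    {h : Euc m} (hh : ‖h‖ = 1) {t : ℝ} (ht : 0 < t) :
    rMinDirDeriv f x ≤ (f (x + t • h) - f x) / t := by
  have h1 : rMinDirDeriv f x ≤ rDirDeriv f x h :=
    Real.iInf_le_of_iInf_pos hpos ⟨h, by simpa using hh⟩
  exact h1.trans (Real.iInf_le_of_iInf_pos (hpos.trans_le h1) ⟨t, ht⟩)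

end SystemErrorBound

/-- Theorem 4.1, (i) ⇒ (ii). -/
theorem stmt16 {m : ℕ} {I : Type*} [TopologicalSpace I] [CompactSpace I] [T2Space I]
    [Nonempty I] (F : I → Euc m → ℝ) (hconv : ∀ i, ConvexOn ℝ Set.univ (F i))
    (hcont : Continuous fun p : I × Euc m => F p.1 p.2) (xbar : Euc m)
    (hx : fmax F xbar = 0) (hmin : rMinDirDeriv (fmax F) xbar ≠ 0) :
    ∃ c > (0:ℝ), ∃ ε > (0:ℝ), ∀ G : I → Euc m → ℝ,
      (Continuous fun p : I × Euc m => G p.1 p.2) →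
      (∀ i, ConvexOn ℝ Set.univ (G i)) →
      fmax G xbar = 0 →
      (rMinDirDeriv (fmax F) xbar < 0 → activeSet G xbar ⊆ activeSet F xbar) →
      (0 < rMinDirDeriv (fmax F) xbar → activeSet F xbar ⊆ activeSet G xbar) →
      (∀ i ∈ activeSet F xbar ∩ activeSet G xbar,
        limsup (fun x => ENNReal.ofReal |F i x - G i x - (F i xbar - G i xbar)| / edist x xbar)
          (𝓝[≠] xbar) ≤ ENNReal.ofReal ε) →
      tauMinLocSys G xbar ≤ ENNReal.ofReal c := by
  rcases lt_or_gt_of_ne hmin with hneg | hpos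
  · obtain ⟨h, hh, t, ht, hslope⟩ := exists_slope_neg_of_rMinDirDeriv_neg hneg
    rw [hx, sub_zero] at hslope
    obtain ⟨ρ, hρ⟩ : ∃ ρ, ρ = -(fmax F (xbar + t • h) / t) := ⟨_, rfl⟩
    have hρ0 : 0 < ρ := by rw [hρ]; linarith
    refine ⟨2 / (ρ / 2), by positivity, ρ / 8, by positivity,
      fun G hGcont hGconv hGx hact _ hlim => ?_⟩
    obtain ⟨s, hs, hlt⟩ : ∃ s : ℝ, 0 < s ∧ ∀ i, G i (xbar + s • h) < -(ρ / 2) * s := by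
      by_contra! hcon
      obtain ⟨i, hi0, hi⟩ := exists_forall_mul_le_ray hGcont hGconv
        (fun i => hGx ▸ le_fmax hGcont i xbar) hcon
      have hiG : i ∈ activeSet G xbar := hi0.trans hGx.symm
      have hiF : i ∈ activeSet F xbar := hact hneg hiG
      have hF0 : F i xbar = 0 := Eq.trans hiF hx
      have hev := eventually_abs_ray_le_of_limsup_le (ε' := ρ / 4) hh (by positivity)
        (by linarith) (hlim i ⟨hiF, hiG⟩)
      obtain ⟨s, hs, hs0, hst⟩ := (hev.and (Ioc_mem_nhdsGT ht)).exists
      have h1 := (hconv i).mul_ray_le (h := h) hF0.le hs0 hst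
      have h2 : F i (xbar + t • h) ≤ -ρ * t := by
        have h3 : fmax F (xbar + t • h) = -ρ * t := by rw [hρ]; field_simp
        exact h3 ▸ le_fmax hcont i _
      have h4 : F i (xbar + s • h) ≤ -ρ * s := by
        refine le_of_mul_le_mul_left (h1.trans ?_) ht
        nlinarith
      have h5 := (abs_le.1 hs).1
      have h6 := hi s hs0
      rw [hF0, hi0] at h5
      nlinarith [mul_pos hρ0 hs0]
    refine tauMinLocSys_le_of_slater hGcont hGconv (by positivity) hs (z := xbar + s • h) ?_
      fun i => (hlt i).le
    simp [dist_eq_norm, norm_smul, hh, abs_of_pos hs]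
  · obtain ⟨σ, hσ⟩ : ∃ σ, σ = rMinDirDeriv (fmax F) xbar := ⟨_, rfl⟩
    have hσ0 : 0 < σ := hσ ▸ hpos
    refine ⟨2 / σ, by positivity, σ / 4, by positivity,
      fun G hGcont hGconv hGx _ hact hlim => ?_⟩
    have hgrow : ∀ h : Euc m, ‖h‖ = 1 → ∀ t : ℝ, 0 < t → σ / 2 * t ≤ fmax G (xbar + t • h) := by
      intro h hh t ht
      obtain ⟨i, hi0, hi⟩ := exists_forall_mul_le_ray (a := σ) (h := h) hcont hconv
        (fun i => hx ▸ le_fmax hcont i xbar) fun s hs => by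
          obtain ⟨i, hi⟩ := exists_eq_fmax hcont (xbar + s • h)
          have hle := rMinDirDeriv_le_slope hpos hh hs
          rw [hx, sub_zero, ← hσ, le_div_iff₀ hs] at hle
          exact ⟨i, hi ▸ hle⟩
      have hiF : i ∈ activeSet F xbar := hi0.trans hx.symm
      have hiG : i ∈ activeSet G xbar := hact hpos hiF
      have hG0 : G i xbar = 0 := Eq.trans hiG hGx
      have hev := eventually_abs_ray_le_of_limsup_le (ε' := σ / 2) hh (by positivity)
        (by linarith) (hlim i ⟨hiF, hiG⟩)
      obtain ⟨s, hs, hs0, hst⟩ := (hev.and (Ioc_mem_nhdsGT ht)).exists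
      have h1 := (hGconv i).mul_ray_le (h := h) hG0.le hs0 hst
      have h2 := (abs_le.1 hs).2
      have h3 := hi s hs0
      rw [hG0, hi0] at h2
      refine le_trans (le_of_mul_le_mul_left (le_trans ?_ h1) hs0) (le_fmax hGcont i _)
      have h4 : σ / 2 * s ≤ G i (xbar + s • h) := by linarith
      nlinarith
    refine tauMinLocSys_le (by positivity) one_pos fun x _ =>
      ⟨xbar, fun i => hGx ▸ le_fmax hGcont i xbar, ?_⟩
    rcases eq_or_ne x xbar with rfl | hne
    · rw [dist_self]
      positivity
    have hn : 0 < ‖x - xbar‖ := norm_pos_iff.2 (sub_ne_zero.2 hne)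
    have h1 := hgrow (‖x - xbar‖⁻¹ • (x - xbar)) (by
        rw [norm_smul, norm_inv, norm_norm, inv_mul_cancel₀ hn.ne']) _ hn
    rw [smul_inv_smul₀ hn.ne', add_sub_cancel] at h1
    rw [dist_eq_norm]
    calc ‖x - xbar‖ = 2 / σ * (σ / 2 * ‖x - xbar‖) := by field_simp
      _ ≤ 2 / σ * max (fmax G x) 0 := by
        gcongr
        exact h1.trans (le_max_left _ _)
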